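/- For every ε > 0 there exists a natural number K such that for all integers s and k with |k| ≥ K, ‖H₀(s,k)‖ ≤ ε. (The bound is uniform in s.) -/

import Mathlib

/-- The discrete harmonic measure of the tip of the slit in the slit lattice plane,
`H₀(s,k) = (1/(2π)) ∫_{−π}^{π} (cos θ/(1+|sin θ|))^{|k|} e^{−isθ} (1−e^{−2iθ})^{−1/2} dθ`. -/
noncomputable def H0 (s k : ℤ) : ℂ :=
  (1 / (2 * (Real.pi : ℂ))) *
    ∫ θ in (-Real.pi)..Real.pi,
      ((Real.cos θ / (1 + |Real.sin θ|) : ℝ) : ℂ) ^ k.natAbs *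
        Complex.exp (-Complex.I * (s : ℂ) * (θ : ℂ)) *
        ((1 : ℂ) - Complex.exp (-2 * Complex.I * (θ : ℂ))) ^ (-(1 / 2) : ℂ)

open MeasureTheory Filter Topology in
lemma aux_int (a b c : ℝ) :
    IntervalIntegrable (fun x : ℝ => |x - c| ^ (-(1/2) : ℝ)) volume a b := by
  have h : IntervalIntegrable (fun x : ℝ => (x : ℂ) ^ ((-(1/2) : ℝ) : ℂ)) volume (a - c) (b - c) :=
    intervalIntegral.intervalIntegrable_cpow' (by rw [Complex.ofReal_re]; norm_num)
  have h2 := (h.norm).comp_sub_right c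
  simpa only [Complex.norm_cpow_real, Complex.norm_real, Real.norm_eq_abs, sub_add_cancel] using h2

lemma aux_norm (θ : ℝ) :
    ‖((1 : ℂ) - Complex.exp (-2 * Complex.I * (θ : ℂ))) ^ (-(1 / 2) : ℂ)‖
      = |2 * Real.sin θ| ^ (-(1/2) : ℝ) := by
  have e : (-(1 / 2) : ℂ) = ((-(1/2) : ℝ) : ℂ) := by push_cast; rfl
  rw [e, Complex.norm_cpow_real]
  congr 1
  have e2 : (-2 * Complex.I * (θ : ℂ)) = Complex.I * ((-2 * θ : ℝ) : ℂ) := by push_cast; ring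
  rw [e2, norm_sub_rev, Complex.norm_exp_I_mul_ofReal_sub_one, Real.norm_eq_abs]
  rw [show -2 * θ / 2 = -θ by ring, Real.sin_neg, mul_neg, abs_neg]

lemma aux_le (x : ℝ) (hx : |x| ≤ Real.pi / 2) (y : ℝ) (hy : |Real.sin y| = |Real.sin x|) :
    |2 * Real.sin y| ^ (-(1/2) : ℝ) ≤ |x| ^ (-(1/2) : ℝ) := by
  rcases eq_or_ne x 0 with rfl | h0
  · simp at hy
    simp [hy]
  · have hp : 0 < |x| := abs_pos.mpr h0
    apply Real.rpow_le_rpow_of_nonpos hp _ (by norm_num)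
    have h := Real.mul_abs_le_abs_sin hx
    rw [abs_mul, hy, abs_two]
    have : 1 / 2 ≤ 2 / Real.pi := by
      rw [div_le_div_iff₀ (by norm_num) Real.pi_pos]; linarith [Real.pi_le_four]
    nlinarith

lemma aux_dom (θ : ℝ) (h : θ ∈ Set.uIoc (-Real.pi) Real.pi) :
    |2 * Real.sin θ| ^ (-(1/2) : ℝ) ≤ |θ - 0| ^ (-(1/2) : ℝ) + |θ - Real.pi| ^ (-(1/2) : ℝ)
      + |θ - (-Real.pi)| ^ (-(1/2) : ℝ) := by
  have hpi := Real.pi_pos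
  rw [Set.uIoc_of_le (by linarith)] at h
  obtain ⟨h1, h2⟩ := h
  have a1 := Real.rpow_nonneg (abs_nonneg (θ - 0)) (-(1/2) : ℝ)
  have a2 := Real.rpow_nonneg (abs_nonneg (θ - Real.pi)) (-(1/2) : ℝ)
  have a3 := Real.rpow_nonneg (abs_nonneg (θ - (-Real.pi))) (-(1/2) : ℝ)
  by_cases c1 : Real.pi / 2 < θ
  · have := aux_le (θ - Real.pi) (by rw [abs_le]; constructor <;> linarith) θ
      (by rw [Real.sin_sub_pi, abs_neg])
    linarith
  by_cases c2 : θ < - (Real.pi / 2)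
  · have := aux_le (θ - (-Real.pi)) (by rw [abs_le]; constructor <;> linarith) θ
      (by rw [sub_neg_eq_add, Real.sin_add_pi, abs_neg])
    linarith
  · have := aux_le (θ - 0) (by rw [abs_le]; constructor <;> linarith) θ (by rw [sub_zero])
    linarith

lemma aux_C (θ : ℝ) : |Real.cos θ / (1 + |Real.sin θ|)| ≤ 1 := by
  have h := abs_nonneg (Real.sin θ)
  rw [abs_div, abs_of_pos (by linarith : 0 < 1 + |Real.sin θ|), div_le_one (by linarith)]
  linarith [Real.abs_cos_le_one θ]

lemma aux_C_lt (θ : ℝ) (hs : Real.sin θ ≠ 0) : |Real.cos θ / (1 + |Real.sin θ|)| < 1 := by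
  have h := abs_pos.mpr hs
  rw [abs_div, abs_of_pos (by linarith : 0 < 1 + |Real.sin θ|), div_lt_one (by linarith)]
  linarith [Real.abs_cos_le_one θ]

open MeasureTheory Filter Topology in
lemma aux_tendsto : Tendsto (fun n : ℕ => ∫ θ in (-Real.pi)..Real.pi,
    |Real.cos θ / (1 + |Real.sin θ|)| ^ n * |2 * Real.sin θ| ^ (-(1/2) : ℝ)) atTop (𝓝 0) := by
  have h0 : (0 : ℝ) = ∫ θ in (-Real.pi)..Real.pi, (0 : ℝ) := by simp
  rw [h0]
  apply intervalIntegral.tendsto_integral_filter_of_dominated_convergence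
    (fun θ => |θ - 0| ^ (-(1/2) : ℝ) + |θ - Real.pi| ^ (-(1/2) : ℝ)
      + |θ - (-Real.pi)| ^ (-(1/2) : ℝ))
  · refine Eventually.of_forall fun n => Measurable.aestronglyMeasurable ?_
    apply Measurable.mul
    · have := Real.measurable_cos
      have := Real.measurable_sin
      simp only [← Real.norm_eq_abs]
      fun_prop
    · have := Real.measurable_sin
      simp only [← Real.norm_eq_abs]
      fun_prop
  · refine Eventually.of_forall fun n => Eventually.of_forall fun θ hθ => ?_
    have b := Real.rpow_nonneg (abs_nonneg (2 * Real.sin θ)) (-(1/2) : ℝ)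
    have c := pow_le_one₀ (n := n) (abs_nonneg _) (aux_C θ)
    rw [Real.norm_of_nonneg (by positivity)]
    exact (mul_le_of_le_one_left b c).trans (aux_dom θ hθ)
  · exact ((aux_int _ _ _).add (aux_int _ _ _)).add (aux_int _ _ _)
  · refine Eventually.of_forall fun θ _ => ?_
    by_cases hs : Real.sin θ = 0
    · simp [hs]
    · have := (tendsto_pow_atTop_nhds_zero_of_lt_one (abs_nonneg _) (aux_C_lt θ hs)).mul_const
        (|2 * Real.sin θ| ^ (-(1/2) : ℝ))
      simpa only [zero_mul] using this

lemma aux_H0 (s k : ℤ) : ‖H0 s k‖ ≤ ∫ θ in (-Real.pi)..Real.pi,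
    |Real.cos θ / (1 + |Real.sin θ|)| ^ k.natAbs * |2 * Real.sin θ| ^ (-(1/2) : ℝ) := by
  have hpi := Real.pi_pos
  have key := intervalIntegral.norm_integral_le_integral_norm (μ := MeasureTheory.volume)
    (a := -Real.pi) (b := Real.pi)
    (f := fun θ : ℝ => ((Real.cos θ / (1 + |Real.sin θ|) : ℝ) : ℂ) ^ k.natAbs *
        Complex.exp (-Complex.I * (s : ℂ) * (θ : ℂ)) *
        ((1 : ℂ) - Complex.exp (-2 * Complex.I * (θ : ℂ))) ^ (-(1 / 2) : ℂ)) (by linarith)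
  have e : ∀ θ : ℝ, ‖((Real.cos θ / (1 + |Real.sin θ|) : ℝ) : ℂ) ^ k.natAbs *
        Complex.exp (-Complex.I * (s : ℂ) * (θ : ℂ)) *
        ((1 : ℂ) - Complex.exp (-2 * Complex.I * (θ : ℂ))) ^ (-(1 / 2) : ℂ)‖
      = |Real.cos θ / (1 + |Real.sin θ|)| ^ k.natAbs * |2 * Real.sin θ| ^ (-(1/2) : ℝ) := by
    intro θ
    have e1 : -Complex.I * (s : ℂ) * (θ : ℂ) = ((-(s : ℝ) * θ : ℝ) : ℂ) * Complex.I := by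
      push_cast; ring
    rw [norm_mul, norm_mul, aux_norm, e1, Complex.norm_exp_ofReal_mul_I, mul_one, norm_pow,
      Complex.norm_real, Real.norm_eq_abs]
  simp only [e] at key
  have c : ‖(1 / (2 * (Real.pi : ℂ)))‖ ≤ 1 := by
    rw [norm_div, norm_mul, Complex.norm_real, Real.norm_of_nonneg hpi.le]
    simp only [norm_one, Complex.norm_ofNat]
    rw [div_le_one (by positivity)]
    linarith [Real.pi_gt_three]
  unfold H0
  rw [norm_mul]
  exact (mul_le_of_le_one_left (norm_nonneg _) c).trans key

theorem H0_uniform_decay_vertical (ε : ℝ) (hε : 0 < ε) :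
    ∃ K : ℕ, ∀ s k : ℤ, (K : ℤ) ≤ |k| → ‖H0 s k‖ ≤ ε := by
  obtain ⟨K, hK⟩ := Filter.eventually_atTop.mp (aux_tendsto.eventually (gt_mem_nhds hε))
  refine ⟨K, fun s k hk => (aux_H0 s k).trans (hK k.natAbs ?_).le⟩
  rw [Int.abs_eq_natAbs] at hk
  exact_mod_cast hk
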